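/- Let (𝒳, d) be a metric space. If there exists an isometric embedding from 𝒳 into a separable Hilbert space H, then the pseudometric space (𝒳, d^β) is of negative type for every β ∈ (0, 2] and of strong negative type for every β ∈ (0, 2). -/

import Mathlib

open MeasureTheory Filter Topology

noncomputable section

/-- A (pseudo)metric `ρ` on `X` is of negative type if there is a Hilbert space `H'` and a
map `φ : X → H'` with `ρ(x,x') = ‖φ(x) − φ(x')‖²` for all `x, x'`. -/
def IsNegativeType {X : Type*} (ρ : X → X → ℝ) : Prop :=
  ∃ (H' : Type) (_ : NormedAddCommGroup H') (_ : InnerProductSpace ℝ H')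
    (_ : CompleteSpace H') (φ : X → H'), ∀ x x' : X, ρ x x' = ‖φ x - φ x'‖ ^ 2

/-- A (pseudo)metric `ρ` on `X` is of strong negative type if it is of negative type and
for all probability measures `μ₁, μ₂` with finite first `ρ`-moments,
`D(μ₁ − μ₂) = ∫ ρ d((μ₁−μ₂)×(μ₁−μ₂)) = 0` implies `μ₁ = μ₂`. -/
def IsStrongNegativeType {X : Type*} [MeasurableSpace X] (ρ : X → X → ℝ) : Prop :=
  IsNegativeType ρ ∧
  ∀ (μ₁ μ₂ : Measure X), IsProbabilityMeasure μ₁ → IsProbabilityMeasure μ₂ →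
    (∃ x₀, Integrable (fun x => ρ x x₀) μ₁) → (∃ x₀, Integrable (fun x => ρ x x₀) μ₂) →
    (∫ p : X × X, ρ p.1 p.2 ∂(μ₁.prod μ₁)) - 2 * (∫ p : X × X, ρ p.1 p.2 ∂(μ₁.prod μ₂))
      + (∫ p : X × X, ρ p.1 p.2 ∂(μ₂.prod μ₂)) = 0 →
    μ₁ = μ₂


lemma exists_feature {X : Type*} [Small.{0} X] (k : Matrix X X ℝ) (hk : k.PosSemidef) :
    ∃ (H' : Type) (_ : NormedAddCommGroup H') (_ : InnerProductSpace ℝ H')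
    (_ : CompleteSpace H') (φ : X → H'), ∀ x y : X, inner ℝ (φ x) (φ y) = k x y := by
  let e := equivShrink.{0} X
  let K : Matrix (Shrink.{0} X) (Shrink.{0} X) (ℝ →L[ℝ] ℝ) :=
    fun a b => k (e.symm a) (e.symm b) • ContinuousLinearMap.id ℝ ℝ
  have hK : K.PosSemidef := by
    have hT := (RKHS.posSemidef_tfae (K := K)).out 0 2 rfl rfl
    refine hT.mpr ⟨?_, ?_⟩
    · ext a b
      have := hk.1.apply (e.symm a) (e.symm b)
      simp only [star_trivial] at this
      have h2 : star (K b a) = K a b := by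
        simp only [K, star_smul, star_trivial, this]
        congr 1
        exact ContinuousLinearMap.adjoint_id
      simp [h2]
    · intro v
      have := (hk.submatrix e.symm).2 v
      refine this.trans_eq ?_
      rw [RCLike.re_to_real, Finsupp.sum_comm]
      apply Finsupp.sum_congr
      intro a _
      apply Finsupp.sum_congr
      intro b _
      simp [K]
      ring
  have : Fact K.PosSemidef := ⟨hK⟩
  refine ⟨RKHS.OfKernel K, inferInstance, inferInstance, inferInstance,
    fun x => RKHS.kerFun (RKHS.OfKernel K) (e x) (1:ℝ), fun x y => ?_⟩
  rw [← RKHS.kernel_inner, RKHS.OfKernel.kernel_ofKernel]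
  have := hk.1.apply x y
  simp only [star_trivial] at this
  simp [K, this]

lemma psd_of_sum {X : Type*} (k : X → X → ℝ) (hs : ∀ x y, k x y = k y x)
    (h : ∀ c : X →₀ ℝ, 0 ≤ ∑ i ∈ c.support, ∑ j ∈ c.support, c i * k i j * c j) :
    (Matrix.of k).PosSemidef := by
  constructor
  · ext a b; simp [hs a b]
  · intro c; simpa [Finsupp.sum] using h c

lemma psd_sum {X : Type*} {k : Matrix X X ℝ} (h : k.PosSemidef) (c : X →₀ ℝ) :
    0 ≤ ∑ i ∈ c.support, ∑ j ∈ c.support, c i * k i j * c j := by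
  simpa [Finsupp.sum] using h.2 c

lemma psd_gram {X H : Type*} [NormedAddCommGroup H] [InnerProductSpace ℝ H] (f : X → H) :
    (Matrix.of fun x y => inner ℝ (f x) (f y)).PosSemidef := by
  apply psd_of_sum
  · intro x y; exact real_inner_comm _ _
  · intro c
    have : (0:ℝ) ≤ inner ℝ (∑ i ∈ c.support, c i • f i) (∑ i ∈ c.support, c i • f i) :=
      real_inner_self_nonneg
    rw [sum_inner] at this
    refine this.trans_eq (Finset.sum_congr rfl fun i _ => ?_)
    rw [inner_sum]
    refine (Finset.sum_congr rfl fun j _ => ?_)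
    rw [real_inner_smul_left, real_inner_smul_right]; ring

lemma psd_hadamard {X : Type*} {k l : X → X → ℝ} (h : (Matrix.of k).PosSemidef)
    (h' : (Matrix.of l).PosSemidef) : (Matrix.of fun x y => k x y * l x y).PosSemidef :=
  h.hadamard h'

lemma psd_pow {X : Type*} (k : X → X → ℝ) (h : (Matrix.of k).PosSemidef) (n : ℕ) :
    (Matrix.of fun x y => k x y ^ n).PosSemidef := by
  induction n with
  | zero =>
    have := psd_gram (fun _ : X => (1:ℝ))
    simpa using this
  | succ n ih =>
    simpa only [pow_succ] using psd_hadamard ih h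

lemma psd_exp {X : Type*} (k : X → X → ℝ) (h : (Matrix.of k).PosSemidef) :
    (Matrix.of fun x y => Real.exp (k x y)).PosSemidef := by
  apply psd_of_sum
  · intro x y
    have := h.1.apply x y
    simp at this; rw [this]
  · intro c
    have hs : HasSum (fun n : ℕ => ∑ i ∈ c.support, ∑ j ∈ c.support,
        c i * (k i j ^ n / n.factorial) * c j)
        (∑ i ∈ c.support, ∑ j ∈ c.support, c i * Real.exp (k i j) * c j) := by
      refine hasSum_sum fun i _ => hasSum_sum fun j _ => ?_
      refine HasSum.mul_right _ (HasSum.mul_left _ ?_)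
      rw [Real.exp_eq_exp_ℝ]
      exact NormedSpace.exp_series_hasSum_exp' (𝕂 := ℝ) (k i j) |>.congr_fun (by
        intro n; simp [div_eq_inv_mul])
    refine hs.nonneg fun n => ?_
    have := psd_sum (psd_pow k h n) c
    have h2 := div_nonneg this (Nat.cast_nonneg (α := ℝ) n.factorial)
    refine h2.trans_eq ?_
    rw [Finset.sum_div]
    refine Finset.sum_congr rfl fun i _ => ?_
    rw [Finset.sum_div]
    refine Finset.sum_congr rfl fun j _ => ?_
    simp; ring

lemma psd_gauss {X H : Type*} [NormedAddCommGroup H] [InnerProductSpace ℝ H] (f : X → H)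
    {s : ℝ} (hs : 0 ≤ s) :
    (Matrix.of fun x y => Real.exp (-(s * ‖f x - f y‖ ^ 2))).PosSemidef := by
  have h1 := psd_exp (fun x y => 2 * s * inner ℝ (f x) (f y)) (by
    have := (psd_gram f).smul (a := 2 * s) (by positivity)
    exact this)
  have h2 := psd_gram (fun x => Real.exp (-(s * ‖f x‖ ^ 2)))
  convert psd_hadamard h1 h2 using 4 with x y
  simp only [RCLike.inner_apply, conj_trivial, ← Real.exp_add]
  rw [@norm_sub_sq_real]
  congr 1; ring

lemma small_of_emb {X H : Type*} [MetricSpace X] [NormedAddCommGroup H]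
    [TopologicalSpace.SeparableSpace H] (f : X → H) (hf : ∀ x x' : X, ‖f x - f x'‖ = dist x x') :
    Small.{0} X := by
  let u := TopologicalSpace.denseSeq H
  refine small_of_injective (β := ℕ → ℝ) (f := fun x n => dist (f x) (u n)) ?_
  intro x y hxy
  rw [← dist_eq_zero, ← hf, ← dist_eq_norm]
  have h : ∀ z, dist (f x) z = dist (f y) z := by
    have hc : ∀ w : H, Continuous fun z => dist w z := fun w => by fun_prop
    have := (TopologicalSpace.denseRange_denseSeq H).equalizer (hc (f x)) (hc (f y))
      (funext fun n => congrFun hxy n)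
    exact congrFun this
  rw [h, dist_self]

lemma one_sub_exp_nonneg {x : ℝ} (hx : 0 ≤ x) : 0 ≤ 1 - Real.exp (-x) := by
  have : Real.exp (-x) ≤ 1 := Real.exp_le_one_iff.2 (by linarith)
  linarith

lemma bern_int {α : ℝ} (h0 : 0 < α) (h1 : α < 1) :
    IntegrableOn (fun s : ℝ => (1 - Real.exp (-s)) * s ^ (-1 - α)) (Set.Ioi 0) := by
  have hm : Measurable (fun s : ℝ => (1 - Real.exp (-s)) * s ^ (-1 - α)) := by fun_prop
  rw [← Set.Ioc_union_Ioi_eq_Ioi (zero_le_one (α := ℝ))]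
  refine IntegrableOn.union ?_ ?_
  · have hi : IntegrableOn (fun s : ℝ => s ^ (-α)) (Set.Ioc 0 1) := by
      rw [← intervalIntegrable_iff_integrableOn_Ioc_of_le zero_le_one]
      exact intervalIntegral.intervalIntegrable_rpow' (by linarith)
    refine Integrable.mono' hi hm.aestronglyMeasurable ?_
    filter_upwards [ae_restrict_mem measurableSet_Ioc] with s hs
    have hs0 : 0 < s := hs.1
    have := one_sub_exp_nonneg hs0.le
    rw [Real.norm_of_nonneg (by positivity)]
    have h2 : 1 - Real.exp (-s) ≤ s := by linarith [Real.add_one_le_exp (-s)]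
    calc _ ≤ s * s ^ (-1 - α) := by gcongr
      _ = s ^ (-α) := by
        rw [← Real.rpow_one_add' hs0.le (by linarith)]; congr 1; ring
  · have hi : IntegrableOn (fun s : ℝ => s ^ (-1 - α)) (Set.Ioi 1) :=
      integrableOn_Ioi_rpow_of_lt (by linarith) one_pos
    refine Integrable.mono' hi hm.aestronglyMeasurable ?_
    filter_upwards [ae_restrict_mem measurableSet_Ioi] with s hs
    have hs0 : 0 < s := one_pos.trans hs
    have := one_sub_exp_nonneg hs0.le
    rw [Real.norm_of_nonneg (by positivity)]
    have h2 : 1 - Real.exp (-s) ≤ 1 := by linarith [Real.exp_pos (-s)]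
    calc _ ≤ 1 * s ^ (-1 - α) := by gcongr
      _ = _ := one_mul _

def bernC (α : ℝ) : ℝ := ∫ s in Set.Ioi 0, (1 - Real.exp (-s)) * s ^ (-1 - α)

lemma bernC_pos {α : ℝ} (h0 : 0 < α) (h1 : α < 1) : 0 < bernC α := by
  have hp : ∀ s ∈ Set.Ioi (0:ℝ), 0 < (1 - Real.exp (-s)) * s ^ (-1 - α) := by
    intro s hs
    have hs : 0 < s := hs
    have : Real.exp (-s) < 1 := Real.exp_lt_one_iff.2 (by linarith)
    have : 0 < 1 - Real.exp (-s) := by linarith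
    positivity
  rw [bernC, setIntegral_pos_iff_support_of_nonneg_ae _ (bern_int h0 h1)]
  · refine lt_of_lt_of_le ?_ (measure_mono (s := Set.Ioi (0:ℝ)) fun s hs => ⟨(hp s hs).ne', hs⟩)
    simp
  · filter_upwards [ae_restrict_mem measurableSet_Ioi] with s hs using (hp s hs).le

lemma bern_eq {α r s : ℝ} (hr : 0 < r) (hs : 0 < s) :
    (1 - Real.exp (-(s * r))) * s ^ (-1 - α)
      = r ^ (1 + α) * ((1 - Real.exp (-(r * s))) * (r * s) ^ (-1 - α)) := by
  rw [Real.mul_rpow hr.le hs.le, mul_comm s r]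
  have : r ^ (1 + α) * r ^ (-1 - α) = 1 := by
    rw [← Real.rpow_add hr]; simp
  linear_combination (-(1 - Real.exp (-(r * s))) * s ^ (-1 - α)) * this

lemma bern_int_r {α r : ℝ} (h0 : 0 < α) (h1 : α < 1) (hr : 0 ≤ r) :
    IntegrableOn (fun s : ℝ => (1 - Real.exp (-(s * r))) * s ^ (-1 - α)) (Set.Ioi 0) := by
  rcases hr.eq_or_lt with rfl | hr
  · simp
  · have := (integrableOn_Ioi_comp_mul_left_iff
      (fun s : ℝ => (1 - Real.exp (-s)) * s ^ (-1 - α)) 0 hr).2 (by simpa using bern_int h0 h1)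
    refine IntegrableOn.congr_fun (this.const_mul (r ^ (1 + α))) ?_ measurableSet_Ioi
    intro s hs
    exact (bern_eq hr hs).symm

lemma bern_integral {α r : ℝ} (h0 : 0 < α) (hr : 0 ≤ r) :
    ∫ s in Set.Ioi 0, (1 - Real.exp (-(s * r))) * s ^ (-1 - α) = r ^ α * bernC α := by
  rcases hr.eq_or_lt with rfl | hr
  · simp [Real.zero_rpow h0.ne']
  · rw [setIntegral_congr_fun measurableSet_Ioi (fun s hs => bern_eq hr hs),
      integral_const_mul, integral_comp_mul_left_Ioi
      (fun s : ℝ => (1 - Real.exp (-s)) * s ^ (-1 - α)) 0 hr, mul_zero, smul_eq_mul, ← mul_assoc]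
    rw [bernC]
    congr 1
    rw [Real.rpow_add hr, Real.rpow_one]; field_simp

lemma bern_fubini {Ω : Type*} [MeasurableSpace Ω] (μ : Measure Ω) [IsFiniteMeasure μ]
    {r : Ω → ℝ} (hm : Measurable r) (hr : ∀ ω, 0 ≤ r ω) {α : ℝ} (h0 : 0 < α) (h1 : α < 1)
    (hi : Integrable (fun ω => r ω ^ α) μ) :
    IntegrableOn (fun s : ℝ => ∫ ω, (1 - Real.exp (-(s * r ω))) * s ^ (-1 - α) ∂μ) (Set.Ioi 0) ∧
    ∫ s in Set.Ioi (0:ℝ), ∫ ω, (1 - Real.exp (-(s * r ω))) * s ^ (-1 - α) ∂μ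
      = (∫ ω, r ω ^ α ∂μ) * bernC α := by
  have hI : Integrable (Function.uncurry
      fun (ω : Ω) (s : ℝ) => (1 - Real.exp (-(s * r ω))) * s ^ (-1 - α))
      (μ.prod (volume.restrict (Set.Ioi 0))) := by
    rw [integrable_prod_iff (by
      refine Measurable.aestronglyMeasurable ?_
      simp only [Function.uncurry_def]
      fun_prop)]
    refine ⟨ae_of_all _ fun ω => bern_int_r h0 h1 (hr ω), ?_⟩
    refine (hi.mul_const (bernC α)).congr (ae_of_all _ fun ω => ?_)
    simp only [Function.uncurry_def]
    rw [← bern_integral h0 (hr ω)]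
    refine setIntegral_congr_fun measurableSet_Ioi fun s hs => ?_
    have hs : 0 < s := hs
    have := one_sub_exp_nonneg (mul_nonneg hs.le (hr ω))
    exact (Real.norm_of_nonneg (by positivity)).symm
  refine ⟨hI.integral_prod_right, ?_⟩
  rw [← integral_integral_swap hI, ← integral_mul_const]
  exact integral_congr_ae (ae_of_all _ fun ω => bern_integral h0 (hr ω))

lemma sq_rpow_half {t β : ℝ} (ht : 0 ≤ t) : (t ^ 2) ^ (β / 2) = t ^ β := by
  rw [← Real.rpow_natCast, ← Real.rpow_mul ht]; congr 1; push_cast; ring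

lemma psd_energy {X H : Type*} [NormedAddCommGroup H] [InnerProductSpace ℝ H]
    [TopologicalSpace.SeparableSpace H] (f : X → H) {β : ℝ} (h0 : 0 < β) (h2 : β < 2) :
    (Matrix.of fun x y => ‖f x‖ ^ β + ‖f y‖ ^ β - ‖f x - f y‖ ^ β).PosSemidef := by
  have : Small.{0} H := small_of_emb (id : H → H) (fun x y => (dist_eq_norm x y).symm)
  apply psd_of_sum
  · intro x y; rw [norm_sub_rev]; ring
  intro c
  have ha0 : 0 < β / 2 := by linarith
  have ha1 : β / 2 < 1 := by linarith
  have hC := bernC_pos ha0 ha1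
  let g : H → ℝ → ℝ := fun z s => (1 - Real.exp (-(s * ‖z‖ ^ 2))) * s ^ (-1 - β / 2)
  have hgi : ∀ z, IntegrableOn (g z) (Set.Ioi 0) := fun z => bern_int_r ha0 ha1 (by positivity)
  have hg : ∀ z, ∫ s in Set.Ioi 0, g z s = ‖z‖ ^ β * bernC (β / 2) := fun z => by
    rw [← sq_rpow_half (norm_nonneg z)]
    exact bern_integral ha0 (by positivity)
  have hgij : ∀ i j, IntegrableOn (fun s => c i * (g (f i) s + g (f j) s - g (f i - f j) s) * c j)
      (Set.Ioi 0) := fun i j =>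
    ((((hgi _).add (hgi _)).sub (hgi _)).const_mul _).mul_const _
  have key : (∑ i ∈ c.support, ∑ j ∈ c.support,
      c i * (‖f i‖ ^ β + ‖f j‖ ^ β - ‖f i - f j‖ ^ β) * c j) * bernC (β / 2) =
      ∫ s in Set.Ioi 0, ∑ i ∈ c.support, ∑ j ∈ c.support,
        c i * (g (f i) s + g (f j) s - g (f i - f j) s) * c j := by
    rw [integral_finsetSum _ (fun i _ => integrable_finsetSum _ (fun j _ => hgij i j)),
      Finset.sum_mul]
    refine Finset.sum_congr rfl fun i _ => ?_
    rw [integral_finsetSum _ (fun j _ => hgij i j), Finset.sum_mul]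
    refine Finset.sum_congr rfl fun j _ => ?_
    rw [integral_mul_const, integral_const_mul, integral_sub (f := fun s => g (f i) s + g (f j) s)
      ((hgi _).add (hgi _)) (hgi _), integral_add (hgi _) (hgi _), hg, hg, hg]
    ring
  refine nonneg_of_mul_nonneg_left (b := bernC (β / 2)) ?_ hC
  rw [key]
  refine setIntegral_nonneg measurableSet_Ioi fun s hs => ?_
  have hs : 0 < s := hs
  obtain ⟨K, _, _, _, Ψ, hΨ⟩ := exists_feature _ (psd_gauss (id : H → H) hs.le)
  have h3 := psd_sum (psd_gram fun x => Ψ (f x) - Ψ 0) c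
  have h4 : 0 ≤ s ^ (-1 - β / 2) := by positivity
  refine (mul_nonneg h4 h3).trans_eq ?_
  rw [Finset.mul_sum]
  refine Finset.sum_congr rfl fun i _ => ?_
  rw [Finset.mul_sum]
  refine Finset.sum_congr rfl fun j _ => ?_
  simp only [Matrix.of_apply, inner_sub_left, inner_sub_right, hΨ, g, id, sub_zero, zero_sub,
    norm_neg, norm_zero]
  simp
  ring

lemma negType {X H : Type*} [MetricSpace X] [NormedAddCommGroup H] [InnerProductSpace ℝ H]
    [TopologicalSpace.SeparableSpace H] (f : X → H) (hf : ∀ x x' : X, ‖f x - f x'‖ = dist x x')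
    {β : ℝ} (h0 : 0 < β) (h2 : β ≤ 2) : IsNegativeType (fun x x' : X => dist x x' ^ β) := by
  have := small_of_emb f hf
  rcases h2.eq_or_lt with rfl | h2
  · obtain ⟨K, i1, i2, i3, Ψ, hΨ⟩ := exists_feature _ (psd_gram f)
    refine ⟨K, i1, i2, i3, Ψ, fun x y => ?_⟩
    simp only [Matrix.of_apply] at hΨ
    beta_reduce
    rw [← hf, Real.rpow_two, @norm_sub_sq_real, @norm_sub_sq_real, ← real_inner_self_eq_norm_sq,
      ← real_inner_self_eq_norm_sq, ← real_inner_self_eq_norm_sq, ← real_inner_self_eq_norm_sq,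
      hΨ, hΨ, hΨ]
  · have hp := (psd_energy f h0 h2).smul (a := (1 / 2 : ℝ)) (by norm_num)
    obtain ⟨K, i1, i2, i3, Ψ, hΨ⟩ := exists_feature _ hp
    refine ⟨K, i1, i2, i3, Ψ, fun x y => ?_⟩
    simp only [Matrix.smul_apply, Matrix.of_apply] at hΨ
    beta_reduce
    rw [@norm_sub_sq_real, ← real_inner_self_eq_norm_sq,
      ← real_inner_self_eq_norm_sq, hΨ, hΨ, hΨ, ← hf]
    simp only [sub_self, norm_zero, Real.zero_rpow h0.ne',
      smul_eq_mul]
    ring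

/-- MMD for the Gaussian kernel. -/
lemma gauss_mmd {X H : Type*} [MetricSpace X] [MeasurableSpace X] [BorelSpace X]
    [NormedAddCommGroup H] [InnerProductSpace ℝ H]
    [TopologicalSpace.SeparableSpace H] (f : X → H) (hf : ∀ x x' : X, ‖f x - f x'‖ = dist x x')
    [SecondCountableTopology X]
    (μ₁ μ₂ : Measure X) [IsProbabilityMeasure μ₁] [IsProbabilityMeasure μ₂] {s : ℝ} (hs : 0 ≤ s) :
    0 ≤ (∫ p : X × X, Real.exp (-(s * dist p.1 p.2 ^ 2)) ∂(μ₁.prod μ₁))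
        - 2 * (∫ p : X × X, Real.exp (-(s * dist p.1 p.2 ^ 2)) ∂(μ₁.prod μ₂))
        + (∫ p : X × X, Real.exp (-(s * dist p.1 p.2 ^ 2)) ∂(μ₂.prod μ₂)) ∧
    ((∫ p : X × X, Real.exp (-(s * dist p.1 p.2 ^ 2)) ∂(μ₁.prod μ₁))
        - 2 * (∫ p : X × X, Real.exp (-(s * dist p.1 p.2 ^ 2)) ∂(μ₁.prod μ₂))
        + (∫ p : X × X, Real.exp (-(s * dist p.1 p.2 ^ 2)) ∂(μ₂.prod μ₂)) = 0 →
      ∀ z : H, ∫ x, Real.exp (-(s * ‖f x - z‖ ^ 2)) ∂μ₁ =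
        ∫ x, Real.exp (-(s * ‖f x - z‖ ^ 2)) ∂μ₂) := by
  have : Small.{0} H := small_of_emb (id : H → H) (fun x y => (dist_eq_norm x y).symm)
  obtain ⟨K, _, _, _, Ψ, hΨ⟩ := exists_feature _ (psd_gauss (id : H → H) hs)
  simp only [Matrix.of_apply, id] at hΨ
  have hfc : Continuous f := (Isometry.of_dist_eq fun x y => by
    rw [dist_eq_norm, hf]).continuous
  have hn : ∀ x, ‖Ψ x‖ = 1 := fun x => by
    have : ‖Ψ x‖ ^ 2 = 1 := by rw [← real_inner_self_eq_norm_sq, hΨ]; simp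
    nlinarith [norm_nonneg (Ψ x)]
  have hΨc : Continuous Ψ := by
    rw [continuous_iff_continuousAt]
    intro x
    rw [ContinuousAt, tendsto_iff_norm_sub_tendsto_zero]
    have h : ∀ y, ‖Ψ y - Ψ x‖ = √(2 - 2 * Real.exp (-(s * ‖y - x‖ ^ 2))) := fun y => by
      rw [← hΨ, ← Real.sqrt_sq (norm_nonneg (Ψ y - Ψ x)), @norm_sub_sq_real, hn, hn]
      congr 1; ring
    simp only [h]
    have : Continuous fun y => √(2 - 2 * Real.exp (-(s * ‖y - x‖ ^ 2))) := by fun_prop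
    simpa using this.tendsto x
  let Φ := fun x => Ψ (f x)
  have hΦc : Continuous Φ := hΨc.comp hfc
  have hint : ∀ μ : Measure X, IsProbabilityMeasure μ → Integrable Φ μ := fun μ _ =>
    Integrable.of_bound hΦc.aestronglyMeasurable 1 (ae_of_all _ fun x => (hn _).le)
  have hin : ∀ μ : Measure X, IsProbabilityMeasure μ → ∀ v : K,
      inner ℝ v (∫ x, Φ x ∂μ) = ∫ x, inner ℝ v (Φ x) ∂μ := fun μ hμ v =>
    (integral_inner (hint μ hμ) v).symm
  have hprod : ∀ μ ν : Measure X, IsProbabilityMeasure μ → IsProbabilityMeasure ν →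
      ∫ p : X × X, Real.exp (-(s * dist p.1 p.2 ^ 2)) ∂(μ.prod ν)
        = inner ℝ (∫ x, Φ x ∂μ) (∫ x, Φ x ∂ν) := by
    intro μ ν hμ hν
    rw [integral_prod]
    · rw [real_inner_comm, hin μ hμ]
      refine integral_congr_ae (ae_of_all _ fun x => ?_)
      simp only
      rw [real_inner_comm, hin ν hν]
      refine integral_congr_ae (ae_of_all _ fun y => ?_)
      simp only [Φ, hΨ, hf]
    · refine Integrable.of_bound (Continuous.aestronglyMeasurable (by fun_prop)) 1
        (ae_of_all _ fun p => ?_)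
      rw [Real.norm_of_nonneg (Real.exp_pos _).le]
      refine Real.exp_le_one_iff.2 ?_
      have : 0 ≤ s * dist p.1 p.2 ^ 2 := by positivity
      linarith
  rw [hprod _ _ ‹_› ‹_›, hprod _ _ ‹_› ‹_›, hprod _ _ ‹_› ‹_›,
    real_inner_self_eq_norm_sq, real_inner_self_eq_norm_sq, ← @norm_sub_sq_real]
  refine ⟨by positivity, fun h z => ?_⟩
  have h : ∫ x, Φ x ∂μ₁ = ∫ x, Φ x ∂μ₂ := by
    rwa [sq_eq_zero_iff, norm_eq_zero, sub_eq_zero] at h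
  have h3 := congrArg (inner ℝ (Ψ z)) h
  rw [hin _ ‹_›, hin _ ‹_›] at h3
  simpa only [Φ, hΨ, norm_sub_rev z] using h3

lemma gauss_char {X H : Type*} [MetricSpace X] [MeasurableSpace X] [BorelSpace X]
    [NormedAddCommGroup H] [InnerProductSpace ℝ H] [CompleteSpace H]
    [TopologicalSpace.SeparableSpace H] (f : X → H) (hf : ∀ x x' : X, ‖f x - f x'‖ = dist x x')
    (μ₁ μ₂ : Measure X) [IsProbabilityMeasure μ₁] [IsProbabilityMeasure μ₂] {s : ℝ} (hs : 0 < s)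
    (h : ∀ z : H, ∫ x, Real.exp (-(s * ‖f x - z‖ ^ 2)) ∂μ₁ =
        ∫ x, Real.exp (-(s * ‖f x - z‖ ^ 2)) ∂μ₂) : μ₁ = μ₂ := by
  borelize H
  have : SecondCountableTopology H := UniformSpace.secondCountable_of_separable H
  have hiso : Isometry f := Isometry.of_dist_eq fun x y => by rw [dist_eq_norm, hf]
  have hfc : Continuous f := hiso.continuous
  have hfm : Measurable f := hfc.measurable
  let w : X → ENNReal := fun x => ENNReal.ofReal (Real.exp (-(s * ‖f x‖ ^ 2)))
  have hwm : Measurable w := by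
    have : Continuous fun x => Real.exp (-(s * ‖f x‖ ^ 2)) := by fun_prop
    exact this.measurable.ennreal_ofReal
  have hw0 : ∀ x, w x ≠ 0 := fun x => by simp [w, Real.exp_pos]
  have hwt : ∀ x, w x ≠ ⊤ := fun x => by simp [w]
  have hwr : ∀ x, (w x).toReal = Real.exp (-(s * ‖f x‖ ^ 2)) := fun x => by
    simp [w, Real.exp_nonneg]
  let ν : Measure X → Measure X := fun μ => μ.withDensity w
  have hfin : ∀ μ : Measure X, IsProbabilityMeasure μ → IsFiniteMeasure (ν μ) := fun μ _ => by
    refine isFiniteMeasure_withDensity_ofReal ?_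
    refine (Integrable.of_bound (C := 1) (Continuous.aestronglyMeasurable (by fun_prop))
      (ae_of_all _ fun x => ?_)).2
    rw [Real.norm_of_nonneg (Real.exp_pos _).le]
    refine Real.exp_le_one_iff.2 ?_
    have : 0 ≤ s * ‖f x‖ ^ 2 := by positivity
    linarith
  have hne : ∀ μ : Measure X, IsProbabilityMeasure μ → ν μ ≠ 0 := fun μ hμ h0 => by
    rw [withDensity_eq_zero_iff hwm.aemeasurable] at h0
    obtain ⟨x, hx⟩ := h0.exists
    exact hw0 x hx
  have := hfin μ₁ inferInstance
  have := hfin μ₂ inferInstance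
  have hexp : ∀ (u : H) (t : ℝ) (x : X), (w x).toReal • Real.exp (t * inner ℝ (f x) u) =
      Real.exp (s * ‖(t / (2 * s)) • u‖ ^ 2) *
        Real.exp (-(s * ‖f x - (t / (2 * s)) • u‖ ^ 2)) := fun u t x => by
    rw [hwr, smul_eq_mul, ← Real.exp_add, ← Real.exp_add, @norm_sub_sq_real,
      real_inner_smul_right]
    congr 1
    field_simp
    ring
  have hmgf : ∀ u : H, ProbabilityTheory.mgf (fun x => inner ℝ (f x) u) (ν μ₁) =
      ProbabilityTheory.mgf (fun x => inner ℝ (f x) u) (ν μ₂) := fun u => by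
    funext t
    simp only [ProbabilityTheory.mgf, ν]
    rw [integral_withDensity_eq_integral_toReal_smul hwm
        (ae_of_all _ fun x => (hwt x).lt_top),
      integral_withDensity_eq_integral_toReal_smul hwm
        (ae_of_all _ fun x => (hwt x).lt_top)]
    simp only [hexp]
    rw [integral_const_mul, integral_const_mul, h]
  have hset : ∀ u : H, ProbabilityTheory.integrableExpSet (fun x => inner ℝ (f x) u) (ν μ₁)
      = Set.univ := fun u => by
    rw [Set.eq_univ_iff_forall]
    intro t
    change Integrable _ (μ₁.withDensity w)
    rw [integrable_withDensity_iff_integrable_smul' hwm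
        (ae_of_all _ fun x => (hwt x).lt_top)]
    simp only [hexp]
    refine Integrable.const_mul ?_ _
    refine (Integrable.of_bound (C := 1) (Continuous.aestronglyMeasurable (by fun_prop))
      (ae_of_all _ fun x => ?_))
    rw [Real.norm_of_nonneg (Real.exp_pos _).le]
    refine Real.exp_le_one_iff.2 ?_
    have : 0 ≤ s * ‖f x - (t / (2 * s)) • u‖ ^ 2 := by positivity
    linarith
  have hmap : (ν μ₁).map f = (ν μ₂).map f := by
    apply Measure.ext_of_charFun
    funext u
    rw [charFun_apply, charFun_apply, integral_map hfm.aemeasurable (by fun_prop),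
      integral_map hfm.aemeasurable (by fun_prop)]
    have := ProbabilityTheory.eqOn_complexMGF_of_mgf' (hmgf u)
      (by simp [hne μ₁ inferInstance, hne μ₂ inferInstance]) (x := Complex.I)
      (by simp [hset])
    simpa only [ProbabilityTheory.complexMGF, mul_comm Complex.I] using this
  have hν : ν μ₁ = ν μ₂ := by
    ext A hA
    have : ∃ B, MeasurableSet B ∧ f ⁻¹' B = A := by
      rw [BorelSpace.measurable_eq (α := X), hiso.isUniformInducing.isInducing.eq_induced,
        borel_comap] at hA
      obtain ⟨B, hB, rfl⟩ := hA
      exact ⟨B, by rwa [BorelSpace.measurable_eq (α := H)], rfl⟩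
    obtain ⟨B, hB, rfl⟩ := this
    rw [← Measure.map_apply hfm hB, hmap, Measure.map_apply hfm hB]
  have hinv : ∀ μ : Measure X, (ν μ).withDensity (fun x => (w x)⁻¹) = μ := fun μ =>
    withDensity_inv_same hwm (ae_of_all _ hw0) (ae_of_all _ hwt)
  rw [← hinv μ₁, hν, hinv]

lemma integrable_dist_rpow {X : Type*} [MetricSpace X] [MeasurableSpace X] [BorelSpace X]
    [SecondCountableTopology X] (μ ν : Measure X) [IsProbabilityMeasure μ]
    [IsProbabilityMeasure ν] {β : ℝ} (h0 : 0 < β)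
    (hμ : ∃ x₀, Integrable (fun x => dist x x₀ ^ β) μ)
    (hν : ∃ x₀, Integrable (fun x => dist x x₀ ^ β) ν) :
    Integrable (fun p : X × X => dist p.1 p.2 ^ β) (μ.prod ν) := by
  have hq : ∀ a b : ℝ, 0 ≤ a → 0 ≤ b → (a + b) ^ β ≤ 2 ^ β * (a ^ β + b ^ β) := by
    intro a b ha hb
    have h1 : (a + b) ^ β ≤ (2 * max a b) ^ β := by
      refine Real.rpow_le_rpow (by positivity) ?_ h0.le
      linarith [le_max_left a b, le_max_right a b]
    rw [Real.mul_rpow (by norm_num) (by positivity)] at h1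
    refine h1.trans ?_
    gcongr
    have := Real.rpow_nonneg ha β
    have := Real.rpow_nonneg hb β
    rcases max_choice a b with h | h <;> rw [h] <;> linarith
  have hc : ∀ x₀ : X, Continuous fun x => dist x x₀ ^ β := fun x₀ =>
    (continuous_id.dist continuous_const).rpow_const (fun _ => Or.inr h0.le)
  obtain ⟨a, ha⟩ := hμ
  obtain ⟨b, hb⟩ := hν
  have hb' : Integrable (fun x => dist x a ^ β) ν := by
    refine ((hb.add (integrable_const (dist b a ^ β))).const_mul (2 ^ β)).mono'
      (hc a).aestronglyMeasurable (ae_of_all _ fun x => ?_)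
    rw [Real.norm_of_nonneg (by positivity)]
    exact (Real.rpow_le_rpow dist_nonneg (dist_triangle x b a) h0.le).trans
      (hq _ _ dist_nonneg dist_nonneg)
  refine (((ha.comp_fst ν).add (hb'.comp_snd μ)).const_mul (2 ^ β)).mono'
      (Continuous.aestronglyMeasurable
        ((continuous_fst.dist continuous_snd).rpow_const (fun _ => Or.inr h0.le)))
      (ae_of_all _ fun p => ?_)
  rw [Real.norm_of_nonneg (by positivity)]
  refine (Real.rpow_le_rpow dist_nonneg (dist_triangle_right p.1 p.2 a) h0.le).trans
      (hq _ _ dist_nonneg dist_nonneg)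

/-- If a metric space `(𝒳, d)` embeds isometrically into a separable
Hilbert space, then `(𝒳, d^β)` is of negative type for every `β ∈ (0,2]` and of strong
negative type for every `β ∈ (0,2)`. -/
theorem isometric_embedding_power_negative_type
    {X : Type*} [MetricSpace X] [MeasurableSpace X] [BorelSpace X]
    {H : Type*} [NormedAddCommGroup H] [InnerProductSpace ℝ H] [CompleteSpace H]
    [TopologicalSpace.SeparableSpace H]
    (φemb : X → H) (hφ : ∀ x x' : X, ‖φemb x - φemb x'‖ = dist x x') :
    (∀ β ∈ Set.Ioc (0 : ℝ) 2,
      IsNegativeType (fun x x' : X => dist x x' ^ β)) ∧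
    (∀ β ∈ Set.Ioo (0 : ℝ) 2,
      IsStrongNegativeType (fun x x' : X => dist x x' ^ β)) := by
  refine ⟨fun β hβ => negType φemb hφ hβ.1 hβ.2, fun β hβ => ⟨negType φemb hφ hβ.1 hβ.2.le, ?_⟩⟩
  intro μ₁ μ₂ _ _ hi₁ hi₂ hD
  obtain ⟨h0, h2⟩ := hβ
  have : SecondCountableTopology H := UniformSpace.secondCountable_of_separable H
  have hiso : Isometry φemb := Isometry.of_dist_eq fun x y => by rw [dist_eq_norm, hφ]
  have : SecondCountableTopology X :=
    hiso.isUniformInducing.isInducing.secondCountableTopology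
  have ha0 : 0 < β / 2 := by linarith
  have ha1 : β / 2 < 1 := by linarith
  let r : X × X → ℝ := fun p => dist p.1 p.2 ^ 2
  have hrm : Measurable r := Continuous.measurable (by fun_prop)
  have hr0 : ∀ p, 0 ≤ r p := fun p => by positivity
  have hrβ : ∀ p, r p ^ (β / 2) = dist p.1 p.2 ^ β := fun p => sq_rpow_half dist_nonneg
  let E : Measure X → Measure X → ℝ → ℝ := fun μ ν s =>
    ∫ p : X × X, (1 - Real.exp (-(s * r p))) * s ^ (-1 - β / 2) ∂(μ.prod ν)
  have hB : ∀ μ ν : Measure X, IsProbabilityMeasure μ → IsProbabilityMeasure ν →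
      (∃ x₀, Integrable (fun x => dist x x₀ ^ β) μ) →
      (∃ x₀, Integrable (fun x => dist x x₀ ^ β) ν) →
      IntegrableOn (E μ ν) (Set.Ioi 0) ∧ ∫ s in Set.Ioi (0:ℝ), E μ ν s =
        (∫ p : X × X, dist p.1 p.2 ^ β ∂(μ.prod ν)) * bernC (β / 2) := by
    intro μ ν hμ hν h1 h2
    have := bern_fubini (μ.prod ν) hrm hr0 ha0 ha1 (by
      simp only [hrβ]; exact integrable_dist_rpow μ ν h0 h1 h2)
    simpa only [hrβ] using this
  obtain ⟨i11, e11⟩ := hB μ₁ μ₁ ‹_› ‹_› hi₁ hi₁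
  obtain ⟨i12, e12⟩ := hB μ₁ μ₂ ‹_› ‹_› hi₁ hi₂
  obtain ⟨i22, e22⟩ := hB μ₂ μ₂ ‹_› ‹_› hi₂ hi₂
  let G : Measure X → Measure X → ℝ → ℝ := fun μ ν s =>
    ∫ p : X × X, Real.exp (-(s * dist p.1 p.2 ^ 2)) ∂(μ.prod ν)
  have hEG : ∀ μ ν : Measure X, IsProbabilityMeasure μ → IsProbabilityMeasure ν → ∀ s : ℝ,
      0 < s → E μ ν s = (1 - G μ ν s) * s ^ (-1 - β / 2) := by
    intro μ ν _ _ s hs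
    simp only [E, G, r]
    rw [integral_mul_const, integral_sub (integrable_const _)]
    · simp
    · refine (Integrable.of_bound (C := 1) (Continuous.aestronglyMeasurable (by fun_prop))
        (ae_of_all _ fun p => ?_))
      rw [Real.norm_of_nonneg (Real.exp_pos _).le]
      refine Real.exp_le_one_iff.2 ?_
      have : 0 ≤ s * dist p.1 p.2 ^ 2 := by positivity
      linarith
  let T : ℝ → ℝ := fun s => 2 * E μ₁ μ₂ s - E μ₁ μ₁ s - E μ₂ μ₂ s
  have hTG : ∀ s, 0 < s → T s =
      (G μ₁ μ₁ s - 2 * G μ₁ μ₂ s + G μ₂ μ₂ s) * s ^ (-1 - β / 2) := fun s hs => by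
    simp only [T]
    rw [hEG _ _ ‹_› ‹_› s hs, hEG _ _ ‹_› ‹_› s hs, hEG _ _ ‹_› ‹_› s hs]; ring
  have i12' : IntegrableOn (fun s => 2 * E μ₁ μ₂ s) (Set.Ioi 0) := i12.const_mul 2
  have i3 : IntegrableOn (fun s => 2 * E μ₁ μ₂ s - E μ₁ μ₁ s) (Set.Ioi 0) := i12'.sub i11
  have hTi : IntegrableOn T (Set.Ioi 0) := i3.sub i22
  have hT0 : ∫ s in Set.Ioi (0:ℝ), T s = 0 := by
    simp only [T]
    rw [integral_sub i3 i22, integral_sub i12' i11, integral_const_mul, e11, e12, e22]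
    linear_combination (-bernC (β / 2)) * hD
  have hTn : 0 ≤ᵐ[volume.restrict (Set.Ioi (0:ℝ))] T := by
    filter_upwards [ae_restrict_mem measurableSet_Ioi] with s hs
    have hs : 0 < s := hs
    rw [hTG s hs]
    exact mul_nonneg (gauss_mmd φemb hφ μ₁ μ₂ hs.le).1 (by positivity)
  rw [integral_eq_zero_iff_of_nonneg_ae hTn hTi] at hT0
  have hne : (volume.restrict (Set.Ioi (0:ℝ))) ≠ 0 := by
    rw [Ne, Measure.restrict_eq_zero]; simp
  have : (ae (volume.restrict (Set.Ioi (0:ℝ)))).NeBot := ae_neBot.2 hne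
  obtain ⟨s, hs, hTs⟩ := ((ae_restrict_mem measurableSet_Ioi).and hT0).exists
  have hs : 0 < s := hs
  rw [hTG s hs] at hTs
  have hG := (mul_eq_zero.1 hTs).resolve_right (by positivity)
  exact gauss_char φemb hφ μ₁ μ₂ hs ((gauss_mmd φemb hφ μ₁ μ₂ hs.le).2 hG)
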